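/- arXiv:0712.3026 — 2 statements merged into one kernel-verified Lean document; each statement's English description precedes it below -/
import Mathlib

section
/- Let T be a positive-weighted tree with leaf set [n], n ≥ 4, with no vertices of degree 2, let D_{i,j} = D_{i,j}(T), and define S_{i,j} := (n−2)D_{i,j} − Σ_{k≠i} D_{i,k} − Σ_{k≠j} D_{j,k} for distinct i, j ∈ [n]. If i and j are neighbours in T, then S_{i,k} − S_{i,j} ≥ 0 for every k ∈ [n]∖{i,j}, and S_{i,k} − S_{i,j} > 0 if and only if k is not a neighbour of i and j (i.e., k is not a leaf of the same bell as i and j). -/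
/-- A weighted tree whose leaves are labeled bijectively by `Fin n`. -/
structure WeightedTree (n : ℕ) where
  V : Type
  [fintypeV : Fintype V]
  [decEqV : DecidableEq V]
  G : SimpleGraph V
  [decAdj : DecidableRel G.Adj]
  isTree : G.IsTree
  w : Sym2 V → ℝ
  leaf : Fin n → V
  leaf_inj : Function.Injective leaf
  leaf_iff : ∀ v : V, (∃ i, leaf i = v) ↔ G.degree v ≤ 1

attribute [instance] WeightedTree.fintypeV WeightedTree.decEqV WeightedTree.decAdj

namespace WeightedTree

variable {n : ℕ}

/-- The unique path between two vertices of a tree. -/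
noncomputable def treePath (T : WeightedTree n) (u v : T.V) : T.G.Walk u v :=
  (T.isTree.existsUnique_path u v).choose

/-- The sum of the weights of the edges on the path from `u` to `v`. -/
noncomputable def pathWeight (T : WeightedTree n) (u v : T.V) : ℝ :=
  ((T.treePath u v).edges.map T.w).sum

open Classical in
/-- The total weight of the minimal subtree spanning the leaves indexed by `S`:
the sum of the weights of the edges lying on a path between two leaves of `S`. -/
noncomputable def D (T : WeightedTree n) (S : Finset (Fin n)) : ℝ :=
  ∑ e ∈ T.G.edgeFinset.filter
      (fun e => ∃ i ∈ S, ∃ j ∈ S, e ∈ (T.treePath (T.leaf i) (T.leaf j)).edges),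
    T.w e

/-- All edge weights are positive. -/
def PosWeights (T : WeightedTree n) : Prop := ∀ e ∈ T.G.edgeSet, 0 < T.w e

/-- Two leaves are neighbours (form a cherry) if the path between them contains
exactly one vertex of degree at least 3. -/
def Neighbours (T : WeightedTree n) (a b : Fin n) : Prop :=
  ∃! z : T.V, z ∈ (T.treePath (T.leaf a) (T.leaf b)).support ∧ 3 ≤ T.G.degree z

end WeightedTree

open WeightedTree

/-- The neighbour-joining matrix
`S_{i,j} = (n-2) D_{i,j} - ∑_{k ≠ i} D_{i,k} - ∑_{k ≠ j} D_{j,k}`. -/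
noncomputable def Smat {n : ℕ} (T : WeightedTree n) (i j : Fin n) : ℝ :=
  ((n : ℝ) - 2) * T.D {i, j} -
    ∑ k ∈ Finset.univ.erase i, T.D {i, k} -
    ∑ k ∈ Finset.univ.erase j, T.D {j, k}

namespace WeightedTree

variable {n : ℕ}

theorem treePath_isPath (T : WeightedTree n) (u v : T.V) : (T.treePath u v).IsPath :=
  (T.isTree.existsUnique_path u v).choose_spec.1

theorem treePath_eq (T : WeightedTree n) {u v : T.V} {p : T.G.Walk u v} (hp : p.IsPath) :
    T.treePath u v = p :=
  ((T.isTree.existsUnique_path u v).choose_spec.2 p hp).symm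

theorem pathWeight_eq (T : WeightedTree n) {u v : T.V} {p : T.G.Walk u v} (hp : p.IsPath) :
    T.pathWeight u v = (p.edges.map T.w).sum := by
  rw [pathWeight, T.treePath_eq hp]

theorem pathWeight_self (T : WeightedTree n) (u : T.V) : T.pathWeight u u = 0 := by
  rw [T.pathWeight_eq SimpleGraph.Walk.IsPath.nil]
  simp

theorem pathWeight_comm (T : WeightedTree n) (u v : T.V) :
    T.pathWeight u v = T.pathWeight v u := by
  rw [T.pathWeight_eq (T.treePath_isPath v u).reverse, pathWeight]
  simp

theorem pathWeight_adj (T : WeightedTree n) {u v : T.V} (h : T.G.Adj u v) :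
    T.pathWeight u v = T.w s(u, v) := by
  rw [T.pathWeight_eq (SimpleGraph.Walk.IsPath.of_adj h)]
  simp

theorem pathWeight_le_walk (T : WeightedTree n) (hpos : T.PosWeights) {u v : T.V}
    (p : T.G.Walk u v) : T.pathWeight u v ≤ (p.edges.map T.w).sum := by
  rw [T.pathWeight_eq p.bypass_isPath]
  refine (p.edges_bypass_sublist_edges.map T.w).sum_le_sum fun x hx => ?_
  obtain ⟨e, he, rfl⟩ := List.mem_map.1 hx
  exact (hpos e (p.edges_subset_edgeSet he)).le

theorem pathWeight_triangle (T : WeightedTree n) (hpos : T.PosWeights) (u v x : T.V) :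
    T.pathWeight u x ≤ T.pathWeight u v + T.pathWeight v x := by
  simpa [pathWeight] using T.pathWeight_le_walk hpos ((T.treePath u v).append (T.treePath v x))

theorem pathWeight_add_of_mem (T : WeightedTree n) {u v x : T.V}
    (h : v ∈ (T.treePath u x).support) :
    T.pathWeight u x = T.pathWeight u v + T.pathWeight v x := by
  have hp := T.treePath_isPath u x
  rw [T.pathWeight_eq (hp.takeUntil h), T.pathWeight_eq (hp.dropUntil h), ← List.sum_append,
    ← List.map_append, ← SimpleGraph.Walk.edges_append, SimpleGraph.Walk.take_spec, pathWeight]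

theorem pathWeight_pos (T : WeightedTree n) (hpos : T.PosWeights) {u v : T.V} (h : u ≠ v) :
    0 < T.pathWeight u v := by
  refine List.sum_pos _ (fun x hx => ?_) ?_
  · obtain ⟨e, he, rfl⟩ := List.mem_map.1 hx
    exact hpos e ((T.treePath u v).edges_subset_edgeSet he)
  · intro hnil
    rw [List.map_eq_nil_iff, SimpleGraph.Walk.edges_eq_nil] at hnil
    exact h hnil.eq

theorem D_pair (T : WeightedTree n) (a b : Fin n) :
    T.D {a, b} = T.pathWeight (T.leaf a) (T.leaf b) := by
  classical
  have hself : ∀ u, T.treePath u u = SimpleGraph.Walk.nil :=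
    fun u => T.treePath_eq SimpleGraph.Walk.IsPath.nil
  have hrev : T.treePath (T.leaf b) (T.leaf a) = (T.treePath (T.leaf a) (T.leaf b)).reverse :=
    T.treePath_eq (T.treePath_isPath _ _).reverse
  rw [D, pathWeight, ← List.sum_toFinset _ (T.treePath_isPath _ _).isTrail.edges_nodup]
  refine Finset.sum_congr ?_ fun _ _ => rfl
  ext e
  have hedge : e ∈ (T.treePath (T.leaf a) (T.leaf b)).edges → e ∈ T.G.edgeSet :=
    fun he => (T.treePath _ _).edges_subset_edgeSet he
  simp only [Finset.mem_filter, Finset.mem_insert, Finset.mem_singleton, exists_eq_or_imp,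
    exists_eq_left, hself, hrev, SimpleGraph.Walk.edges_nil, SimpleGraph.Walk.edges_reverse,
    List.mem_reverse, List.not_mem_nil, List.mem_toFinset, SimpleGraph.mem_edgeFinset]
  tauto

theorem degree_leaf_le_one (T : WeightedTree n) (a : Fin n) : T.G.degree (T.leaf a) ≤ 1 :=
  (T.leaf_iff _).1 ⟨a, rfl⟩

theorem eq_of_adj_leaf (T : WeightedTree n) {a : Fin n} {u v : T.V}
    (hu : T.G.Adj (T.leaf a) u) (hv : T.G.Adj (T.leaf a) v) : u = v :=
  Finset.card_le_one.1 (T.degree_leaf_le_one a) u (by simpa using hu) v (by simpa using hv)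

theorem three_le_degree (T : WeightedTree n) (hdeg : ∀ v : T.V, T.G.degree v ≠ 2) {u v x : T.V}
    (hu : T.G.Adj u v) (hx : T.G.Adj v x) (hux : u ≠ x) : 3 ≤ T.G.degree v := by
  have h : 1 < T.G.degree v :=
    Finset.one_lt_card.2 ⟨u, by simpa using hu.symm, x, by simpa using hx, hux⟩
  have := hdeg v
  omega

theorem pathWeight_leaf (T : WeightedTree n) {a : Fin n} {v x : T.V}
    (h : T.G.Adj (T.leaf a) v) (hx : T.leaf a ≠ x) :
    T.pathWeight (T.leaf a) x = T.pathWeight (T.leaf a) v + T.pathWeight v x := by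
  refine T.pathWeight_add_of_mem ?_
  cases T.treePath (T.leaf a) x with
  | nil => exact absurd rfl hx
  | cons h' p => simp [T.eq_of_adj_leaf h h']

/-- Every vertex `x` lies on a path from `v` to some leaf. -/
theorem exists_leaf_mem_support (T : WeightedTree n) (v x : T.V) :
    ∃ m : Fin n, x ∈ (T.treePath v (T.leaf m)).support := by
  classical
  obtain ⟨y, hy, hmax⟩ := (Finset.univ.filter fun y => x ∈ (T.treePath v y).support).exists_max_image
    (fun y => (T.treePath v y).length) ⟨x, by simp⟩
  simp only [Finset.mem_filter, Finset.mem_univ, true_and] at hy hmax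
  have hdeg : T.G.degree y ≤ 1 := by
    by_contra! h
    obtain ⟨z, hz, hne⟩ := Finset.exists_mem_ne h (T.treePath v y).penultimate
    rw [SimpleGraph.mem_neighborFinset] at hz
    have hp := (T.treePath_isPath v y).concat
      (fun hmem => hne (T.isTree.isAcyclic.eq_penultimate_of_adj_end
        (T.treePath_isPath v y) hz hmem)) hz
    have hle := hmax z (by rw [T.treePath_eq hp]; simp [hy])
    rw [T.treePath_eq hp] at hle
    simp at hle
  obtain ⟨m, rfl⟩ := (T.leaf_iff y).2 hdeg
  exact ⟨m, hy⟩

theorem neighbours_iff (T : WeightedTree n) (hdeg : ∀ v : T.V, T.G.degree v ≠ 2) {a b : Fin n}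
    (hab : a ≠ b) :
    T.Neighbours a b ↔ ∃ v, T.G.Adj (T.leaf a) v ∧ T.G.Adj v (T.leaf b) := by
  have hne : T.leaf a ≠ T.leaf b := T.leaf_inj.ne hab
  have ha := T.degree_leaf_le_one a
  have hb := T.degree_leaf_le_one b
  constructor
  · rintro ⟨z, ⟨hz, hz3⟩, hunique⟩
    have hp := T.treePath_isPath (T.leaf a) (T.leaf b)
    revert hp hz hunique
    dsimp only
    generalize T.treePath (T.leaf a) (T.leaf b) = p
    generalize T.leaf a = u at *
    generalize T.leaf b = x at *
    intro hunique hz hp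
    match p with
    | .nil => exact absurd rfl hne
    | .cons h .nil =>
      simp only [SimpleGraph.Walk.support_cons, SimpleGraph.Walk.support_nil, List.mem_cons,
        List.not_mem_nil, or_false] at hz
      rcases hz with rfl | rfl <;> omega
    | .cons h (.cons h' .nil) => exact ⟨_, h, h'⟩
    | .cons (v := c) h (.cons (v := d) h' (.cons (v := e) h'' q)) =>
      have hq := q.start_mem_support
      simp only [SimpleGraph.Walk.cons_isPath_iff, SimpleGraph.Walk.support_cons, List.mem_cons,
        not_or] at hp
      have hc := hunique c ⟨by simp, T.three_le_degree hdeg h h' hp.2.2.1⟩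
      have hd := hunique d ⟨by simp, T.three_le_degree hdeg h' h''
        fun hce => hp.1.2.2 (hce ▸ hq)⟩
      exact absurd (hc.trans hd.symm) h'.ne
  · rintro ⟨v, hav, hvb⟩
    have hp : (SimpleGraph.Walk.cons hav (SimpleGraph.Walk.cons hvb .nil)).IsPath := by
      simp [SimpleGraph.Walk.cons_isPath_iff, hav.ne, hvb.ne, hne]
    refine ⟨v, ⟨by simp [T.treePath_eq hp], T.three_le_degree hdeg hav hvb hne⟩, ?_⟩
    rintro y ⟨hy, hy3⟩
    simp only [T.treePath_eq hp, SimpleGraph.Walk.support_cons, SimpleGraph.Walk.support_nil,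
      List.mem_cons, List.not_mem_nil, or_false] at hy
    rcases hy with rfl | rfl | rfl
    · omega
    · rfl
    · omega

/-- If the leaf `k` is neither equal nor adjacent to the vertex `v`, then for some other leaf `m`
the path from `k` to `m` avoids `v`, so that the triangle inequality through `v` is strict. -/
theorem exists_leaf_pathWeight_lt (T : WeightedTree n) (hpos : T.PosWeights)
    (hdeg : ∀ v : T.V, T.G.degree v ≠ 2) {v : T.V} {k : Fin n} (hvk : v ≠ T.leaf k)
    (hadj : ¬ T.G.Adj v (T.leaf k)) :
    ∃ m, m ≠ k ∧ T.pathWeight (T.leaf k) (T.leaf m) <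
      T.pathWeight v (T.leaf k) + T.pathWeight v (T.leaf m) := by
  have hnil : ¬ (T.treePath v (T.leaf k)).Nil := fun h => hvk h.eq
  have huk := SimpleGraph.Walk.adj_penultimate hnil
  set u := (T.treePath v (T.leaf k)).penultimate
  have huv : v ≠ u := fun h => hadj (h ▸ huk)
  have hq := T.treePath_isPath v u
  have hnil' : ¬ (T.treePath v u).Nil := fun h => huv h.eq
  have htu := SimpleGraph.Walk.adj_penultimate hnil'
  set t := (T.treePath v u).penultimate
  have hkq : T.leaf k ∉ (T.treePath v u).support := by
    have hp := T.treePath_isPath v (T.leaf k)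
    rw [← SimpleGraph.Walk.concat_dropLast huk, SimpleGraph.Walk.concat_isPath_iff] at hp
    rw [T.treePath_eq hp.1]
    exact hp.2
  have htk : t ≠ T.leaf k := fun h => hkq (h ▸ SimpleGraph.Walk.getVert_mem_support _ _)
  have hcard : ({t, T.leaf k} : Finset T.V).card < (T.G.neighborFinset u).card :=
    lt_of_le_of_lt Finset.card_le_two (T.three_le_degree hdeg htu huk htk)
  obtain ⟨x, hx, hx'⟩ := Finset.exists_mem_notMem_of_card_lt_card hcard
  rw [SimpleGraph.mem_neighborFinset] at hx
  simp only [Finset.mem_insert, Finset.mem_singleton, not_or] at hx'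
  have hpx := hq.concat (fun hmem => hx'.1
    (T.isTree.isAcyclic.eq_penultimate_of_adj_end hq hx hmem)) hx
  obtain ⟨m, hm⟩ := T.exists_leaf_mem_support v x
  have hmk : m ≠ k := by
    rintro rfl
    rw [T.treePath_eq (hq.concat hkq huk), SimpleGraph.Walk.support_concat] at hm
    simp only [List.mem_append, List.mem_singleton, hx'.2, or_false] at hm
    exact hx'.1 (T.isTree.isAcyclic.eq_penultimate_of_adj_end hq hx hm)
  refine ⟨m, hmk, ?_⟩
  have h1 := T.pathWeight_add_of_mem hm
  have h2 := T.pathWeight_add_of_mem (u := v) (v := u) (x := x) (by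
    rw [T.treePath_eq hpx]; simp)
  have h3 := T.pathWeight_add_of_mem (u := v) (v := u) (x := T.leaf k) (by
    rw [T.treePath_eq (hq.concat hkq huk)]; simp)
  have h4 := T.pathWeight_triangle hpos u x (T.leaf m)
  have h5 := T.pathWeight_triangle hpos (T.leaf k) u (T.leaf m)
  have h6 := T.pathWeight_comm u (T.leaf k)
  have h7 := T.pathWeight_pos hpos huv
  linarith

end WeightedTree

/-- The difference of two entries of a row, as a sum of defects of the triangle inequality at the
stalk `v` of the leaf `j`. -/
theorem Smat_sub_Smat {n : ℕ} (T : WeightedTree n) {i j k : Fin n} {v : T.V} (hij : i ≠ j)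
    (hik : i ≠ k) (hi : T.G.Adj (T.leaf i) v) (hj : T.G.Adj (T.leaf j) v) :
    Smat T i k - Smat T i j = ∑ m ∈ Finset.univ.erase k,
      (T.pathWeight v (T.leaf k) + T.pathWeight v (T.leaf m) -
        T.pathWeight (T.leaf k) (T.leaf m)) := by
  have hcard (a : Fin n) : ((Finset.univ.erase a).card : ℝ) = (n : ℝ) - 1 := by
    rw [Finset.card_erase_of_mem (Finset.mem_univ _), Finset.card_univ, Fintype.card_fin,
      Nat.cast_sub (by have := a.pos; omega), Nat.cast_one]
  have hD : ∑ m ∈ Finset.univ.erase j, T.pathWeight (T.leaf j) (T.leaf m) =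
      ∑ m ∈ Finset.univ.erase j,
        (T.pathWeight (T.leaf j) v + T.pathWeight v (T.leaf m)) :=
    Finset.sum_congr rfl fun m hm =>
      T.pathWeight_leaf hj (T.leaf_inj.ne (Finset.ne_of_mem_erase hm).symm)
  have hDij := T.pathWeight_leaf hi (T.leaf_inj.ne hij)
  have hDik := T.pathWeight_leaf hi (T.leaf_inj.ne hik)
  have ej := Finset.add_sum_erase Finset.univ (fun m => T.pathWeight v (T.leaf m))
    (Finset.mem_univ j)
  have ek := Finset.add_sum_erase Finset.univ (fun m => T.pathWeight v (T.leaf m))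
    (Finset.mem_univ k)
  have hcomm := T.pathWeight_comm v (T.leaf j)
  simp only [Smat, T.D_pair]
  rw [hD, Finset.sum_sub_distrib, Finset.sum_add_distrib, Finset.sum_add_distrib,
    Finset.sum_const, Finset.sum_const, nsmul_eq_mul, nsmul_eq_mul, hcard, hcard, hDij, hDik]
  rw [hcomm] at ej ⊢
  linear_combination ej - ek

/-- if `i, j` are neighbours then `S_{i,j}` is minimal in its row:
`S_{i,k} - S_{i,j} ≥ 0` for all `k ≠ i, j`, with strict inequality iff `k` is
not a neighbour of `i` and `j`. -/
theorem nj_neighbours_minimal (n : ℕ) (hn : 4 ≤ n)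
    (T : WeightedTree n) (hpos : T.PosWeights)
    (hdeg : ∀ v : T.V, T.G.degree v ≠ 2)
    (i j : Fin n) (hij : i ≠ j) (hnbr : T.Neighbours i j)
    (k : Fin n) (hki : k ≠ i) (hkj : k ≠ j) :
    0 ≤ Smat T i k - Smat T i j ∧
      (0 < Smat T i k - Smat T i j ↔
        ¬ (T.Neighbours i k ∧ T.Neighbours j k)) := by
  obtain ⟨v, hiv, hvj⟩ := (T.neighbours_iff hdeg hij).1 hnbr
  have hbell : (T.Neighbours i k ∧ T.Neighbours j k) ↔ T.G.Adj v (T.leaf k) := by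
    rw [T.neighbours_iff hdeg hki.symm, T.neighbours_iff hdeg hkj.symm]
    constructor
    · rintro ⟨⟨v', hiv', hvk⟩, -⟩
      rwa [T.eq_of_adj_leaf hiv hiv']
    · exact fun h => ⟨⟨v, hiv, h⟩, v, hvj.symm, h⟩
  have hvk : v ≠ T.leaf k := by
    rintro rfl
    exact hij (T.leaf_inj (T.eq_of_adj_leaf hiv.symm hvj))
  have hnonneg : ∀ m ∈ Finset.univ.erase k, 0 ≤ T.pathWeight v (T.leaf k) +
      T.pathWeight v (T.leaf m) - T.pathWeight (T.leaf k) (T.leaf m) := by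
    intro m _
    have := T.pathWeight_triangle hpos (T.leaf k) v (T.leaf m)
    rw [T.pathWeight_comm (T.leaf k) v] at this
    linarith
  rw [Smat_sub_Smat T hij hki.symm hiv hvj.symm, hbell]
  refine ⟨Finset.sum_nonneg hnonneg, fun hlt hk => ?_, fun hk => ?_⟩
  · refine hlt.ne' (Finset.sum_eq_zero fun m hm => ?_)
    rw [T.pathWeight_leaf hk.symm (T.leaf_inj.ne (Finset.ne_of_mem_erase hm).symm),
      T.pathWeight_comm v (T.leaf k), sub_self]
  · obtain ⟨m, hmk, hm⟩ := T.exists_leaf_pathWeight_lt hpos hdeg hvk hk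
    exact Finset.sum_pos' hnonneg ⟨m, by simp [hmk], by linarith⟩
end

section
/- Let T be a positive-weighted tree with leaf set [n], n ≥ 4, with no vertices of degree 2, let D_{i,j} = D_{i,j}(T), and define S_{i,j} := (n−2)D_{i,j} − Σ_{k≠i} D_{i,k} − Σ_{k≠j} D_{j,k} for distinct i, j ∈ [n]. If the pair (i,j) minimizes S_{i,j} over all pairs of distinct elements of [n], then i and j are neighbours in T. -/
open WeightedTree

namespace SimpleGraph

variable {V : Type*} {G : SimpleGraph V}

/-- Two vertices are joined by a walk that does not use the edge `e`. -/
def ReachableAvoiding (G : SimpleGraph V) (e : Sym2 V) (u v : V) : Prop :=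
  ∃ p : G.Walk u v, e ∉ p.edges

namespace ReachableAvoiding

variable {e f : Sym2 V} {u v w x y : V}

lemma refl (G : SimpleGraph V) (e : Sym2 V) (u : V) : G.ReachableAvoiding e u u :=
  ⟨Walk.nil, by simp⟩

lemma symm (h : G.ReachableAvoiding e u v) : G.ReachableAvoiding e v u := by
  obtain ⟨p, hp⟩ := h
  exact ⟨p.reverse, by simpa using hp⟩

lemma trans (h : G.ReachableAvoiding e u v) (h' : G.ReachableAvoiding e v w) :
    G.ReachableAvoiding e u w := by
  obtain ⟨p, hp⟩ := h
  obtain ⟨q, hq⟩ := h'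
  exact ⟨p.append q, by simp [Walk.edges_append, hp, hq]⟩

lemma of_adj (h : G.Adj u v) (hne : e ≠ s(u, v)) : G.ReachableAvoiding e u v :=
  ⟨Walk.cons h Walk.nil, by simpa using hne⟩

/-- Removing an edge leaves at most two components. -/
lemma left_or_right (hG : G.Connected) (x y v : V) :
    G.ReachableAvoiding s(x, y) v x ∨ G.ReachableAvoiding s(x, y) v y := by
  suffices ∀ z, G.Walk v z → z = x →
      G.ReachableAvoiding s(x, y) v x ∨ G.ReachableAvoiding s(x, y) v y from
    (hG.preconnected v x).elim fun p => this x p rfl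
  intro z p
  induction p with
  | nil => rintro rfl; exact Or.inl (refl G _ _)
  | @cons a b c h p ih =>
    intro hc
    by_cases he : s(x, y) = s(a, b)
    · rcases Sym2.eq_iff.1 he with ⟨rfl, rfl⟩ | ⟨rfl, rfl⟩
      · exact Or.inl (refl G _ _)
      · exact Or.inr (refl G _ _)
    · exact (ih hc).imp (of_adj h he).trans (of_adj h he).trans

lemma of_not_of_not (hG : G.Connected) (h : ¬ G.ReachableAvoiding e u v)
    (h' : ¬ G.ReachableAvoiding e v w) : G.ReachableAvoiding e u w := by
  induction e with
  | h x y =>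
    rcases left_or_right hG x y u with hu | hu <;> rcases left_or_right hG x y v with hv | hv <;>
    rcases left_or_right hG x y w with hw | hw <;>
    first
    | exact hu.trans hw.symm
    | exact absurd (hu.trans hv.symm) h
    | exact absurd (hv.trans hw.symm) h'

lemma iff_notMem_edges (hG : G.IsAcyclic) (p : G.Walk u v) (hp : p.IsPath) :
    G.ReachableAvoiding e u v ↔ e ∉ p.edges := by
  classical
  refine ⟨fun ⟨q, hq⟩ he => hq ?_, fun h => ⟨p, h⟩⟩
  have : p = q.bypass := congrArg Subtype.val
    ((hG.subsingleton_path u v).elim ⟨p, hp⟩ ⟨_, q.bypass_isPath⟩)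
  exact q.edges_bypass_subset_edges (this ▸ he)

lemma not_of_adj (hG : G.IsAcyclic) (h : G.Adj u v) : ¬ G.ReachableAvoiding s(u, v) u v := by
  rw [iff_notMem_edges hG (Walk.cons h Walk.nil) (by simp [h.ne])]
  simp

lemma exists_separating_edge (hG : G.IsTree) (h : u ≠ v) :
    ∃ e ∈ G.edgeSet, ¬ G.ReachableAvoiding e u v := by
  obtain ⟨p, hp, -⟩ := hG.existsUnique_path u v
  cases p with
  | nil => exact absurd rfl h
  | @cons _ z _ a p =>
    exact ⟨s(u, z), a, by rw [iff_notMem_edges hG.isAcyclic _ hp]; simp⟩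

/-- The side of an edge `e` away from an edge `xy` lies on one side of `xy`. -/
lemma of_far (hG : G.IsTree) (hu : ¬ G.ReachableAvoiding e x u)
    (hv : ¬ G.ReachableAvoiding e x v) : G.ReachableAvoiding s(x, y) u v := by
  classical
  obtain ⟨p, hp⟩ := of_not_of_not hG.connected (fun h => hu h.symm) hv
  refine ⟨p, fun hxy => hu ?_⟩
  have hx := p.fst_mem_support_of_mem_edges hxy
  exact symm ⟨p.takeUntil x hx, fun h => hp (p.edges_takeUntil_subset_edges hx h)⟩

/-- A vertex has at most one neighbour in the direction of a given vertex. -/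
lemma parent_unique (hG : G.IsTree) (hx : G.Adj v x) (hy : G.Adj v y)
    (hrx : ¬ G.ReachableAvoiding s(v, x) v w) (hry : ¬ G.ReachableAvoiding s(v, y) v w) :
    x = y := by
  by_contra hne
  have h1 : G.ReachableAvoiding s(v, y) w x := of_far hG hrx (not_of_adj hG.isAcyclic hx)
  have h2 : G.ReachableAvoiding s(v, y) v x := of_adj hx (by simp [Ne.symm hne, hy.ne'])
  exact hry (h2.trans h1.symm)

/-- Only the leaf itself lies on its side of the pendant edge. -/
lemma eq_of_degree_le_one [Fintype (G.neighborSet u)] (hd : G.degree u ≤ 1) (h : G.Adj u v)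
    (hr : G.ReachableAvoiding s(u, v) u w) : w = u := by
  obtain ⟨p, hp⟩ := hr
  cases p with
  | nil => rfl
  | @cons _ z _ a p =>
    have : z = v := Finset.card_le_one.1 hd z (by simpa using a) v (by simpa using h)
    subst this
    simp at hp

end ReachableAvoiding

open ReachableAvoiding

variable {p q u v w : V}

/-- The number of edges separating `v` from the root `q`. -/
noncomputable def sepDepth (G : SimpleGraph V) (q v : V) : ℕ :=
  {e ∈ G.edgeSet | ¬ G.ReachableAvoiding e q v}.ncard

lemma sepDepth_child [Finite V] (hG : G.IsTree) (h : G.Adj v u)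
    (hr : G.ReachableAvoiding s(v, u) q v) : G.sepDepth q u = G.sepDepth q v + 1 := by
  have hu : ¬ G.ReachableAvoiding s(v, u) q u := fun h' =>
    not_of_adj hG.isAcyclic h (hr.symm.trans h')
  unfold sepDepth
  rw [← Set.ncard_insert_of_notMem (a := s(v, u)) (by simp [hr]) (Set.toFinite _)]
  congr 1
  ext e
  by_cases he : e = s(v, u)
  · subst he; simp [hu, h]
  · have := of_adj h he
    have : G.ReachableAvoiding e q u ↔ G.ReachableAvoiding e q v :=
      ⟨fun h => h.trans this.symm, fun h => h.trans this⟩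
    simp [he, this]

lemma child_mem_side (hG : G.IsTree) (hpq : G.Adj p q) (hv : G.ReachableAvoiding s(p, q) p v)
    (h : G.Adj v u) (hr : G.ReachableAvoiding s(v, u) q v) :
    G.ReachableAvoiding s(p, q) p u ∧ u ≠ p := by
  have hne : s(p, q) ≠ s(v, u) := by
    intro he
    rw [← he] at hr
    exact not_of_adj hG.isAcyclic hpq (hv.trans hr.symm)
  refine ⟨hv.trans (of_adj h hne), ?_⟩
  rintro rfl
  exact not_of_adj hG.isAcyclic h (hr.symm.trans (of_adj hpq.symm (by
    rw [Sym2.eq_swap (a := q)]; exact hne.symm)))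

variable [Fintype V] [DecidableRel G.Adj]

lemma degree_le_one_of_deepest (hG : G.IsTree) (hpq : G.Adj p q)
    (hv : G.ReachableAvoiding s(p, q) p v)
    (hmax : ∀ u, G.ReachableAvoiding s(p, q) p u → u ≠ p → G.sepDepth q u ≤ G.sepDepth q v) :
    G.degree v ≤ 1 := by
  by_contra! hd
  obtain ⟨x, hx, y, hy, hxy⟩ := Finset.one_lt_card.1 hd
  rw [mem_neighborFinset] at hx hy
  have key : ∀ z, G.Adj v z → ¬ G.ReachableAvoiding s(v, z) v q := by
    intro z hz hr
    obtain ⟨h1, h2⟩ := child_mem_side hG hpq hv hz hr.symm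
    have := hmax z h1 h2
    rw [sepDepth_child hG hz hr.symm] at this
    omega
  exact hxy (parent_unique hG hx hy (key x hx) (key y hy))

/-- Each side of an edge contains a leaf. -/
lemma exists_leaf_side (hG : G.IsTree) (hpq : G.Adj p q) :
    ∃ v, G.ReachableAvoiding s(p, q) p v ∧ G.degree v ≤ 1 := by
  obtain ⟨v, hv, hmax⟩ := Set.exists_max_image {v | G.ReachableAvoiding s(p, q) p v}
    (G.sepDepth q) (Set.toFinite _) ⟨p, refl G _ _⟩
  exact ⟨v, hv, degree_le_one_of_deepest hG hpq hv fun u hu _ => hmax u hu⟩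

/-- If there is no vertex of degree two, each side of an edge with at least two vertices
contains a cherry. -/
lemma exists_cherry_side (hG : G.IsTree) (hdeg : ∀ v, G.degree v ≠ 2) (hpq : G.Adj p q)
    (hw : G.ReachableAvoiding s(p, q) p w) (hwp : w ≠ p) :
    ∃ a b, a ≠ b ∧ G.ReachableAvoiding s(p, q) p a ∧ G.ReachableAvoiding s(p, q) p b ∧
      G.degree a ≤ 1 ∧ G.degree b ≤ 1 ∧
      ∀ e, ¬ G.ReachableAvoiding e a b →
        (∀ k, G.ReachableAvoiding e a k → k = a) ∨ (∀ k, G.ReachableAvoiding e b k → k = b) := by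
  classical
  obtain ⟨v, ⟨hv, hvp⟩, hmax⟩ := Set.exists_max_image
    {v | G.ReachableAvoiding s(p, q) p v ∧ v ≠ p} (G.sepDepth q) (Set.toFinite _) ⟨w, hw, hwp⟩
  have hmax : ∀ u, G.ReachableAvoiding s(p, q) p u → u ≠ p → G.sepDepth q u ≤ G.sepDepth q v :=
    fun u h h' => hmax u ⟨h, h'⟩
  have hvl := degree_le_one_of_deepest hG hpq hv hmax
  have hqside : ¬ G.ReachableAvoiding s(p, q) p q := not_of_adj hG.isAcyclic hpq
  have hvq : v ≠ q := by rintro rfl; exact hqside hv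
  obtain ⟨u, hvu⟩ : ∃ u, G.Adj v u := by
    obtain ⟨⟨⟩ | ⟨h, _⟩⟩ := hG.connected.preconnected v q
    · exact absurd rfl hvq
    · exact ⟨_, h⟩
  have hne : s(p, q) ≠ s(v, u) := by
    intro he
    rcases Sym2.eq_iff.1 he with ⟨rfl, -⟩ | ⟨-, rfl⟩
    · exact hvp rfl
    · exact hvq rfl
  have hu : G.ReachableAvoiding s(p, q) p u := hv.trans (of_adj hvu hne)
  have huq : u ≠ q := by rintro rfl; exact hqside hu
  have hvu' : G.ReachableAvoiding s(u, v) q u := by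
    by_contra h
    have : G.ReachableAvoiding s(v, u) q v := by
      rw [Sym2.eq_swap]
      exact of_not_of_not hG.connected h (not_of_adj hG.isAcyclic hvu.symm)
    obtain ⟨h1, h2⟩ := child_mem_side hG hpq hv hvu this
    have h3 := hmax u h1 h2
    rw [sepDepth_child hG hvu this] at h3
    omega
  have hdu : 3 ≤ G.degree u := by
    have h2 := hdeg u
    by_contra hlt
    exact huq (eq_of_degree_le_one (by omega) hvu.symm hvu'.symm).symm
  have h2 : 1 < ((G.neighborFinset u).erase v).card := by
    rw [Finset.card_erase_of_mem (by simpa using hvu.symm), card_neighborFinset_eq_degree]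
    omega
  obtain ⟨x, hx, y, hy, hxy⟩ := Finset.one_lt_card.1 h2
  simp only [Finset.mem_erase, mem_neighborFinset] at hx hy
  obtain ⟨b, hbv, hub, hb⟩ :
      ∃ b, b ≠ v ∧ G.Adj u b ∧ G.ReachableAvoiding s(u, b) q u := by
    by_contra! h
    exact hxy (parent_unique hG hx.2 hy.2 (fun hr => h x hx.1 hx.2 hr.symm)
      (fun hr => h y hy.1 hy.2 hr.symm))
  obtain ⟨hb1, hb2⟩ := child_mem_side hG hpq hu hub hb
  have hdb : G.sepDepth q b = G.sepDepth q v := by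
    rw [sepDepth_child hG hub hb, sepDepth_child hG hvu.symm hvu']
  have hbl := degree_le_one_of_deepest hG hpq hb1 (fun z h h' => hdb ▸ hmax z h h')
  refine ⟨v, b, hbv.symm, hv, hb1, hvl, hbl, fun e he => ?_⟩
  by_cases h1 : e = s(v, u)
  · subst h1
    exact Or.inl fun k => eq_of_degree_le_one hvl hvu
  by_cases h2 : e = s(b, u)
  · subst h2
    exact Or.inr fun k => eq_of_degree_le_one hbl hub.symm
  · exact absurd ((of_adj hvu h1).trans (of_adj hub.symm h2).symm) he

end SimpleGraph

namespace WeightedTree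

open SimpleGraph SimpleGraph.ReachableAvoiding

variable {n : ℕ} (T : WeightedTree n)

lemma mem_treePath_edges {u v : T.V} {e : Sym2 T.V} :
    e ∈ (T.treePath u v).edges ↔ ¬ T.G.ReachableAvoiding e u v := by
  rw [iff_notMem_edges T.isTree.isAcyclic (T.treePath u v)
    (T.isTree.existsUnique_path u v).choose_spec.1, not_not]

open Classical in
lemma D_pair_s16 (a b : Fin n) :
    T.D {a, b} = ∑ e ∈ T.G.edgeFinset,
      T.w e * if T.G.ReachableAvoiding e (T.leaf a) (T.leaf b) then 0 else 1 := by
  unfold D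
  rw [Finset.sum_filter]
  refine Finset.sum_congr rfl fun e _ => ?_
  have h1 := fun k => ReachableAvoiding.refl T.G e (T.leaf k)
  have h2 : T.G.ReachableAvoiding e (T.leaf b) (T.leaf a) ↔
      T.G.ReachableAvoiding e (T.leaf a) (T.leaf b) := ⟨symm, symm⟩
  simp only [mem_treePath_edges]
  by_cases h : T.G.ReachableAvoiding e (T.leaf a) (T.leaf b) <;> simp [h, h1, h2]

open Classical in
/-- The leaves separated from the leaf `a` by the edge `e`. -/
noncomputable def farLeaves (e : Sym2 T.V) (a : Fin n) : Finset (Fin n) :=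
  Finset.univ.filter fun k => ¬ T.G.ReachableAvoiding e (T.leaf a) (T.leaf k)

lemma mem_farLeaves {e : Sym2 T.V} {a k : Fin n} :
    k ∈ T.farLeaves e a ↔ ¬ T.G.ReachableAvoiding e (T.leaf a) (T.leaf k) := by
  simp [farLeaves]

open Classical in
/-- The contribution of the edge `e` to `- S_{a,b} / 2`. -/
noncomputable def edgeCoeff (e : Sym2 T.V) (a b : Fin n) : ℕ :=
  if T.G.ReachableAvoiding e (T.leaf a) (T.leaf b) then (T.farLeaves e a).card else 1

lemma edgeCoeff_of_reachable {e : Sym2 T.V} {a b : Fin n}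
    (h : T.G.ReachableAvoiding e (T.leaf a) (T.leaf b)) :
    T.edgeCoeff e a b = (T.farLeaves e a).card := if_pos h

lemma edgeCoeff_of_not_reachable {e : Sym2 T.V} {a b : Fin n}
    (h : ¬ T.G.ReachableAvoiding e (T.leaf a) (T.leaf b)) : T.edgeCoeff e a b = 1 := if_neg h

lemma farLeaves_eq {e : Sym2 T.V} {a b : Fin n}
    (h : T.G.ReachableAvoiding e (T.leaf a) (T.leaf b)) : T.farLeaves e a = T.farLeaves e b := by
  ext k
  simp only [mem_farLeaves, not_iff_not]
  exact ⟨fun h' => h.symm.trans h', fun h' => h.trans h'⟩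

lemma farLeaves_eq_compl {e : Sym2 T.V} {a b : Fin n}
    (h : ¬ T.G.ReachableAvoiding e (T.leaf a) (T.leaf b)) :
    T.farLeaves e b = (T.farLeaves e a)ᶜ := by
  ext k
  simp only [mem_farLeaves, Finset.mem_compl, not_not]
  refine ⟨fun h' => of_not_of_not T.isTree.connected h h', fun h' h'' => h (h'.trans h''.symm)⟩

lemma card_farLeaves_add {e : Sym2 T.V} {a b : Fin n}
    (h : ¬ T.G.ReachableAvoiding e (T.leaf a) (T.leaf b)) :
    (T.farLeaves e a).card + (T.farLeaves e b).card = n := by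
  rw [T.farLeaves_eq_compl h, Finset.card_add_card_compl, Fintype.card_fin]

lemma sum_D (a : Fin n) : ∑ k ∈ Finset.univ.erase a, T.D {a, k} =
    ∑ e ∈ T.G.edgeFinset, T.w e * (T.farLeaves e a).card := by
  classical
  rw [Finset.sum_erase _ (by rw [D_pair_s16]; simp [ReachableAvoiding.refl])]
  simp_rw [D_pair_s16]
  rw [Finset.sum_comm]
  refine Finset.sum_congr rfl fun e _ => ?_
  rw [← Finset.mul_sum, farLeaves, Finset.card_filter]
  push_cast
  simp_rw [ite_not]

lemma Smat_eq (a b : Fin n) :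
    Smat T a b = -2 * ∑ e ∈ T.G.edgeFinset, T.w e * T.edgeCoeff e a b := by
  classical
  rw [Smat, sum_D, sum_D, D_pair_s16, Finset.mul_sum, Finset.mul_sum, ← Finset.sum_sub_distrib,
    ← Finset.sum_sub_distrib]
  refine Finset.sum_congr rfl fun e _ => ?_
  by_cases h : T.G.ReachableAvoiding e (T.leaf a) (T.leaf b)
  · rw [T.edgeCoeff_of_reachable h, T.farLeaves_eq h, if_pos h]
    ring
  · rw [T.edgeCoeff_of_not_reachable h, if_neg h]
    have : ((T.farLeaves e a).card : ℝ) + (T.farLeaves e b).card = n := by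
      exact_mod_cast T.card_farLeaves_add h
    rw [← this]
    push_cast
    ring

lemma exists_leaf_far {e : Sym2 T.V} (he : e ∈ T.G.edgeSet) (v : T.V) :
    ∃ k, ¬ T.G.ReachableAvoiding e v (T.leaf k) := by
  induction e with
  | h x y =>
    have hxy : ¬ T.G.ReachableAvoiding s(x, y) x y := not_of_adj T.isTree.isAcyclic he
    obtain ⟨a, ha, hda⟩ := exists_leaf_side T.isTree (p := x) (q := y) he
    obtain ⟨b, hb, hdb⟩ := exists_leaf_side T.isTree (p := y) (q := x) (Adj.symm he)
    rw [Sym2.eq_swap] at hb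
    obtain ⟨i, rfl⟩ := (T.leaf_iff a).2 hda
    obtain ⟨j, rfl⟩ := (T.leaf_iff b).2 hdb
    by_contra! h
    exact hxy ((ha.trans ((h i).symm.trans (h j))).trans hb.symm)

lemma one_le_edgeCoeff {e : Sym2 T.V} (he : e ∈ T.G.edgeSet) (a b : Fin n) :
    1 ≤ T.edgeCoeff e a b := by
  by_cases h : T.G.ReachableAvoiding e (T.leaf a) (T.leaf b)
  · rw [T.edgeCoeff_of_reachable h, Nat.one_le_iff_ne_zero, Finset.card_ne_zero]
    obtain ⟨k, hk⟩ := T.exists_leaf_far he (T.leaf a)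
    exact ⟨k, T.mem_farLeaves.2 hk⟩
  · rw [T.edgeCoeff_of_not_reachable h]

/-- A cherry on the smaller side of an edge `f` separating `i` and `j` does at least as well as
the pair `i`, `j`, edge by edge. -/
lemma edgeCoeff_le {e f : Sym2 T.V} (he : e ∈ T.G.edgeSet) (hf : f ∈ T.G.edgeSet) (hef : e ≠ f)
    {i j a b : Fin n} (hij : i ≠ j)
    (hfij : ¬ T.G.ReachableAvoiding f (T.leaf i) (T.leaf j))
    (hsmall : n ≤ 2 * (T.farLeaves f a).card)
    (hpend : ¬ T.G.ReachableAvoiding e (T.leaf a) (T.leaf b) →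
      (∀ k, T.G.ReachableAvoiding e (T.leaf a) (T.leaf k) → k = a) ∨
      (∀ k, T.G.ReachableAvoiding e (T.leaf b) (T.leaf k) → k = b)) :
    T.edgeCoeff e i j ≤ T.edgeCoeff e a b := by
  by_cases hs : T.G.ReachableAvoiding e (T.leaf i) (T.leaf j)
  swap
  · rw [T.edgeCoeff_of_not_reachable hs]
    exact T.one_le_edgeCoeff he a b
  induction f with
  | h x y =>
    have hi : T.G.ReachableAvoiding e x (T.leaf i) := by
      by_contra h
      exact hfij (of_far T.isTree h fun h' => h (h'.trans hs.symm))
    rw [T.edgeCoeff_of_reachable hs]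
    by_cases hab : T.G.ReachableAvoiding e (T.leaf a) (T.leaf b)
    · rw [T.edgeCoeff_of_reachable hab]
      by_cases hia : T.G.ReachableAvoiding e (T.leaf i) (T.leaf a)
      · rw [T.farLeaves_eq hia]
      · have h1 := T.card_farLeaves_add hia
        have h2 : (T.farLeaves e i).card ≤ (T.farLeaves s(x, y) a)ᶜ.card := by
          refine Finset.card_le_card fun k hk => ?_
          rw [Finset.mem_compl, mem_farLeaves, not_not]
          rw [mem_farLeaves] at hk
          exact of_far T.isTree (fun h => hia (hi.symm.trans h)) fun h => hk (hi.symm.trans h)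
        have h3 := Finset.card_add_card_compl (T.farLeaves s(x, y) a)
        rw [Fintype.card_fin] at h3
        omega
    · rw [T.edgeCoeff_of_not_reachable hab, Finset.card_le_one]
      have key : ∀ c, (∀ k, T.G.ReachableAvoiding e (T.leaf c) (T.leaf k) → k = c) →
          ∀ k, k ∈ T.farLeaves e i → k = c := by
        intro c hc k hk
        rw [mem_farLeaves] at hk
        refine hc k (of_not_of_not T.isTree.connected (v := T.leaf i) (fun h => hij ?_) hk)
        rw [hc i h, hc j (h.trans hs)]
      intro k hk l hl
      rcases hpend hab with h | h
      · rw [key a h k hk, key a h l hl]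
      · rw [key b h k hk, key b h l hl]

/-- A minimizing pair is not separated by an edge neither of whose sides is a single vertex. -/
lemma not_minimal_of_separated (hpos : T.PosWeights) (hdeg : ∀ v : T.V, T.G.degree v ≠ 2)
    {i j : Fin n} {p q u v : T.V} (hpq : T.G.Adj p q) (hij : i ≠ j)
    (hu : T.G.ReachableAvoiding s(p, q) p u) (hup : u ≠ p)
    (hv : T.G.ReachableAvoiding s(p, q) q v) (hvq : v ≠ q)
    (hfij : ¬ T.G.ReachableAvoiding s(p, q) (T.leaf i) (T.leaf j)) :
    ∃ a b : Fin n, a ≠ b ∧ Smat T a b < Smat T i j := by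
  have hnot : ¬ T.G.ReachableAvoiding s(p, q) p q := not_of_adj T.isTree.isAcyclic hpq
  obtain ⟨a, b, hab, ha, hb, hda, hdb, hcab⟩ := exists_cherry_side T.isTree hdeg hpq hu hup
  obtain ⟨c, d, hcd, hc, hd, hdc, hdd, hccd⟩ := exists_cherry_side T.isTree hdeg hpq.symm
    (by rwa [Sym2.eq_swap]) hvq
  rw [Sym2.eq_swap] at hc hd
  obtain ⟨a, rfl⟩ := (T.leaf_iff a).2 hda
  obtain ⟨b, rfl⟩ := (T.leaf_iff b).2 hdb
  obtain ⟨c, rfl⟩ := (T.leaf_iff c).2 hdc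
  obtain ⟨d, rfl⟩ := (T.leaf_iff d).2 hdd
  have hac : ¬ T.G.ReachableAvoiding s(p, q) (T.leaf a) (T.leaf c) :=
    fun h => hnot ((ha.trans h).trans hc.symm)
  clear hu hup hv hvq hda hdb hdc hdd
  wlog hsmall : n ≤ 2 * (T.farLeaves s(p, q) a).card generalizing a b c d p q
  · have hsum := T.card_farLeaves_add hac
    have hsw : s(q, p) = s(p, q) := Sym2.eq_swap
    exact this hpq.symm (by rwa [hsw]) (by rw [hsw]; exact fun h => hnot h.symm) c
      (by rwa [hsw]) d (by rwa [hsw]) hcd hccd a (by rwa [hsw]) b (by rwa [hsw]) hab hcab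
      (by rw [hsw]; exact fun h => hac h.symm) (by rw [hsw]; omega)
  refine ⟨a, b, fun h => hab (by rw [h]), ?_⟩
  rw [Smat_eq, Smat_eq]
  suffices ∑ e ∈ T.G.edgeFinset, T.w e * T.edgeCoeff e i j <
      ∑ e ∈ T.G.edgeFinset, T.w e * T.edgeCoeff e a b by linarith
  have hstrict : T.edgeCoeff s(p, q) i j < T.edgeCoeff s(p, q) a b := by
    rw [T.edgeCoeff_of_not_reachable hfij, T.edgeCoeff_of_reachable (ha.symm.trans hb),
      Finset.one_lt_card]
    refine ⟨c, T.mem_farLeaves.2 hac, d, T.mem_farLeaves.2 ?_, fun h => hcd (by rw [h])⟩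
    exact fun h => hnot ((ha.trans h).trans hd.symm)
  refine Finset.sum_lt_sum (fun e he => ?_) ⟨s(p, q), by simpa using hpq, ?_⟩
  · rw [mem_edgeFinset] at he
    refine mul_le_mul_of_nonneg_left ?_ (hpos e he).le
    rw [Nat.cast_le]
    by_cases hef : e = s(p, q)
    · rw [hef]; exact hstrict.le
    · refine T.edgeCoeff_le he hpq hef hij hfij hsmall fun h => ?_
      exact (hcab e h).imp (fun h k hk => T.leaf_inj (h _ hk)) fun h k hk => T.leaf_inj (h _ hk)
  · exact mul_lt_mul_of_pos_left (Nat.cast_lt.2 hstrict) (hpos _ hpq)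

lemma exists_adj (hn : 4 ≤ n) (v : T.V) : ∃ u, T.G.Adj v u := by
  obtain ⟨k, hk⟩ : ∃ k, T.leaf k ≠ v := by
    by_contra! h
    have := T.leaf_inj ((h ⟨0, by omega⟩).trans (h ⟨1, by omega⟩).symm)
    simp at this
  obtain ⟨p⟩ := T.isTree.connected.preconnected v (T.leaf k)
  cases p with
  | nil => exact absurd rfl hk
  | cons h _ => exact ⟨_, h⟩

/-- The vertex next to a leaf has degree at least three. -/
lemma three_le_degree_of_adj_leaf (hn : 4 ≤ n) (hdeg : ∀ v : T.V, T.G.degree v ≠ 2)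
    {i : Fin n} {p : T.V} (h : T.G.Adj (T.leaf i) p) : 3 ≤ T.G.degree p := by
  have h2 := hdeg p
  by_contra hlt
  have hi := (T.leaf_iff _).1 ⟨i, rfl⟩
  have hcover : ∀ k, T.leaf k = T.leaf i ∨ T.leaf k = p := by
    intro k
    refine (left_or_right T.isTree.connected (T.leaf i) p (T.leaf k)).imp
      (fun hk => eq_of_degree_le_one hi h hk.symm) fun hk => ?_
    rw [Sym2.eq_swap] at hk
    exact eq_of_degree_le_one (by omega) h.symm hk.symm
  have hcard := Finset.card_le_card (s := Finset.univ.image T.leaf) (t := {T.leaf i, p}) (by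
    intro v hv
    obtain ⟨k, -, rfl⟩ := Finset.mem_image.1 hv
    simpa using hcover k)
  rw [Finset.card_image_of_injective _ T.leaf_inj, Finset.card_univ, Fintype.card_fin] at hcard
  have := Finset.card_le_two (a := T.leaf i) (b := p)
  omega

/-- Two leaves attached to the same vertex are neighbours. -/
lemma neighbours_of_adj (hn : 4 ≤ n) (hdeg : ∀ v : T.V, T.G.degree v ≠ 2) {i j : Fin n}
    (hij : i ≠ j) {p : T.V} (hi : T.G.Adj (T.leaf i) p) (hj : T.G.Adj (T.leaf j) p) :
    T.Neighbours i j := by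
  have hpath : T.treePath (T.leaf i) (T.leaf j) = Walk.cons hi (Walk.cons hj.symm Walk.nil) := by
    refine (T.isTree.existsUnique_path _ _).unique
      (T.isTree.existsUnique_path (T.leaf i) (T.leaf j)).choose_spec.1 ?_
    simp [hi.ne, hj.ne', T.leaf_inj.ne hij]
  have hdi := (T.leaf_iff _).1 ⟨i, rfl⟩
  have hdj := (T.leaf_iff _).1 ⟨j, rfl⟩
  refine ⟨p, ⟨by simp [hpath], T.three_le_degree_of_adj_leaf hn hdeg hi⟩, ?_⟩
  rintro z ⟨hz, hdz⟩
  simp only [hpath, Walk.support_cons, Walk.support_nil, List.mem_cons, List.not_mem_nil,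
    or_false] at hz
  rcases hz with rfl | rfl | rfl
  · omega
  · rfl
  · omega

end WeightedTree

/-- if the pair `(i,j)` minimizes `S` over all pairs of distinct
elements of `[n]`, then `i` and `j` are neighbours. -/
theorem nj_min_implies_neighbours (n : ℕ) (hn : 4 ≤ n)
    (T : WeightedTree n) (hpos : T.PosWeights)
    (hdeg : ∀ v : T.V, T.G.degree v ≠ 2)
    (i j : Fin n) (hij : i ≠ j)
    (hmin : ∀ a b : Fin n, a ≠ b → Smat T i j ≤ Smat T a b) :
    T.Neighbours i j := by
  obtain ⟨p, hp⟩ := T.exists_adj hn (T.leaf i)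
  obtain ⟨q, hq⟩ := T.exists_adj hn (T.leaf j)
  by_cases hpq : p = q
  · subst hpq
    exact T.neighbours_of_adj hn hdeg hij hp hq
  exfalso
  have hdi := (T.leaf_iff _).1 ⟨i, rfl⟩
  have hdj := (T.leaf_iff _).1 ⟨j, rfl⟩
  have hdp := T.three_le_degree_of_adj_leaf hn hdeg hp
  have hdq := T.three_le_degree_of_adj_leaf hn hdeg hq
  obtain ⟨f, hf, hfpq⟩ := SimpleGraph.ReachableAvoiding.exists_separating_edge T.isTree hpq
  have hip : T.G.ReachableAvoiding f (T.leaf i) p := by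
    refine .of_adj hp ?_
    rintro rfl
    have := SimpleGraph.ReachableAvoiding.eq_of_degree_le_one hdi hp
      (SimpleGraph.ReachableAvoiding.of_not_of_not T.isTree.connected
        (SimpleGraph.ReachableAvoiding.not_of_adj T.isTree.isAcyclic hp) hfpq)
    rw [this] at hdq
    omega
  have hjq : T.G.ReachableAvoiding f (T.leaf j) q := by
    refine .of_adj hq ?_
    rintro rfl
    have := SimpleGraph.ReachableAvoiding.eq_of_degree_le_one hdj hq
      (SimpleGraph.ReachableAvoiding.of_not_of_not T.isTree.connected
        (SimpleGraph.ReachableAvoiding.not_of_adj T.isTree.isAcyclic hq) fun h => hfpq h.symm)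
    rw [this] at hdp
    omega
  have hfij : ¬ T.G.ReachableAvoiding f (T.leaf i) (T.leaf j) :=
    fun h => hfpq ((hip.symm.trans h).trans hjq)
  have hother : ∀ x k r, T.G.Adj (T.leaf k) r → T.G.ReachableAvoiding f (T.leaf k) r →
      T.G.ReachableAvoiding f x (T.leaf k) → ∃ u, T.G.ReachableAvoiding f x u ∧ u ≠ x := by
    intro x k r hr hkr hx
    by_cases h : T.leaf k = x
    · exact ⟨r, hx.trans hkr, h ▸ hr.ne'⟩
    · exact ⟨_, hx, h⟩
  induction f with
  | h x y =>
    have hside : ∀ z, ∃ u, T.G.ReachableAvoiding s(x, y) z u ∧ u ≠ z := by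
      intro z
      by_cases h : T.G.ReachableAvoiding s(x, y) z (T.leaf i)
      · exact hother z i p hp hip h
      · exact hother z j q hq hjq (.of_not_of_not T.isTree.connected h hfij)
    obtain ⟨u, hu, hux⟩ := hside x
    obtain ⟨v, hv, hvy⟩ := hside y
    obtain ⟨a, b, hab, hlt⟩ :=
      T.not_minimal_of_separated hpos hdeg hf hij hu hux hv hvy hfij
    exact (hmin a b hab).not_gt hlt
end
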